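/- arXiv:2507.17571 — 2 statements merged into one kernel-verified Lean document; each statement's English description precedes it below -/
import Mathlib

section
/- Characterization of rank (n,ℓ,σ,𝔽_{q'})-equivalence for skew trinomial codes. Let 0 < ℓ < n be integers and let a₀, a_ℓ, b₀, b_ℓ be nonzero elements of 𝔽_q. Then the following are equivalent: (i) there exists a nonzero α ∈ 𝔽_{q'} with a₀·N_n^σ(α) = b₀ and a_ℓ·N_{n−ℓ}^σ(σ^ℓ(α)) = b_ℓ; (ii) the pair (a₀^{−1}b₀, a_ℓ^{−1}b_ℓ) belongs to the cyclic subgroup of 𝔽_q^* × 𝔽_q^* generated by (N_n^σ(ζ), N_{n−ℓ}^σ(σ^ℓ(ζ))). -/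
/-- `sNorm σ i α = σ^{i-1}(α) ⋯ σ(α) · α`, the `i`-th skew norm of `α`. -/
def sNorm {F : Type*} [Field F] (σ : F ≃+* F) (i : ℕ) (α : F) : F :=
  ∏ j ∈ Finset.range i, (⇑σ)^[j] α

theorem sNorm_pow {F : Type*} [Field F] (σ : F ≃+* F) (i : ℕ) (α : F) (m : ℕ) :
    sNorm σ i (α ^ m) = sNorm σ i α ^ m := by
  simp only [sNorm, iterate_map_pow, Finset.prod_pow]

/-- Characterization of rank `(n,ℓ,σ,𝔽_{q'})`-equivalence for skew trinomial codes. -/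
theorem rank_equiv_iff_mem_cyclic
    (p s : ℕ) (hp : p.Prime) (hs : 1 ≤ s)
    (F : Type*) [Field F] [Fintype F] (hF : Fintype.card F = p ^ s)
    (σ : F ≃+* F)
    (K' : Subfield F) (q' : ℕ) (hq' : Nat.card K' = q')
    (ζ : F) (hζK : ζ ∈ K') (hζ0 : ζ ≠ 0)
    (hζ : ∀ x : F, x ∈ K' → x ≠ 0 → ∃ m : ℕ, x = ζ ^ m)
    (ℓ n : ℕ) (hℓ : 0 < ℓ) (hℓn : ℓ < n)
    (a₀ aℓ b₀ bℓ : F) (ha₀ : a₀ ≠ 0) (haℓ : aℓ ≠ 0) (hb₀ : b₀ ≠ 0) (hbℓ : bℓ ≠ 0) :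
    (∃ α : F, α ∈ K' ∧ α ≠ 0 ∧ a₀ * sNorm σ n α = b₀ ∧
        aℓ * sNorm σ (n - ℓ) ((⇑σ)^[ℓ] α) = bℓ) ↔
    (∃ m : ℕ, a₀⁻¹ * b₀ = (sNorm σ n ζ) ^ m ∧
        aℓ⁻¹ * bℓ = (sNorm σ (n - ℓ) ((⇑σ)^[ℓ] ζ)) ^ m) := by
  constructor
  · rintro ⟨α, hαK, hα0, rfl, rfl⟩
    obtain ⟨m, rfl⟩ := hζ α hαK hα0
    refine ⟨m, ?_, ?_⟩
    · rw [inv_mul_cancel_left₀ ha₀, sNorm_pow]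
    · rw [inv_mul_cancel_left₀ haℓ, iterate_map_pow, sNorm_pow]
  · rintro ⟨m, h₀, hₗ⟩
    refine ⟨ζ ^ m, pow_mem hζK m, pow_ne_zero m hζ0, ?_, ?_⟩
    · rw [sNorm_pow, ← h₀, mul_inv_cancel_left₀ ha₀]
    · rw [iterate_map_pow, sNorm_pow, ← hₗ, mul_inv_cancel_left₀ haℓ]
end

section
/- Number of rank (n,ℓ,σ,𝔽_{q'})-equivalence classes for skew trinomial codes. Let 0 < ℓ < n be integers. The cyclic subgroup H_{ℓ,𝔽_{q'}} of 𝔽_q^* × 𝔽_q^* generated by the pair (N_n^σ(ζ), N_{n−ℓ}^σ(σ^ℓ(ζ))) has index (q−1)² / lcm( (q'−1)/gcd([n]_r, q'−1), (q'−1)/gcd([n−ℓ]_r, q'−1) ) in 𝔽_q^* × 𝔽_q^*. -/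
/-- `brk p r i = [i]_r = 1 + p^r + ⋯ + p^{r(i-1)} = (p^{ri} - 1)/(p^r - 1)`. -/
def brk (p r i : ℕ) : ℕ := ∑ j ∈ Finset.range i, p ^ (r * j)

theorem iterate_eq_pow_pow {F : Type*} [Field F] {p r : ℕ} {σ : F ≃+* F}
    (hσ : ∀ a : F, σ a = a ^ p ^ r) (j : ℕ) (a : F) :
    (⇑σ)^[j] a = a ^ p ^ (r * j) := by
  induction j with
  | zero => simp
  | succ j ih => rw [Function.iterate_succ_apply', ih, hσ, ← pow_mul, ← pow_add, mul_add, mul_one]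

theorem sNorm_eq_pow_brk {F : Type*} [Field F] {p r : ℕ} {σ : F ≃+* F}
    (hσ : ∀ a : F, σ a = a ^ p ^ r) (i : ℕ) (a : F) :
    sNorm σ i a = a ^ brk p r i := by
  simp only [sNorm, brk, iterate_eq_pow_pow hσ, Finset.prod_pow_eq_pow_sum]

/-- A generator of the nonzero elements of a finite subfield `K` has order `|K| - 1`. -/
theorem orderOf_eq_card_subfield_sub_one {F : Type*} [Field F] [Finite F] (K : Subfield F)
    {ζ : F} (hζK : ζ ∈ K) (hζ0 : ζ ≠ 0)
    (hζ : ∀ x : F, x ∈ K → x ≠ 0 → ∃ m : ℕ, x = ζ ^ m) :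
    orderOf ζ = Nat.card K - 1 := by
  have hne : (⟨ζ, hζK⟩ : K) ≠ 0 := fun h => hζ0 (congrArg Subtype.val h)
  have hgen : ∀ x : Kˣ, x ∈ Subgroup.zpowers (Units.mk0 (⟨ζ, hζK⟩ : K) hne) := by
    intro x
    obtain ⟨m, hm⟩ := hζ (x : K) (x : K).2 (fun h => x.ne_zero (Subtype.ext h))
    refine ⟨m, Units.ext (Subtype.ext ?_)⟩
    simp [hm]
  have hcard := orderOf_eq_card_of_forall_mem_zpowers hgen
  rw [Nat.card_units, ← orderOf_units, Units.val_mk0] at hcard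
  rw [← hcard]
  exact orderOf_injective K.subtype.toMonoidHom Subtype.val_injective ⟨ζ, hζK⟩

theorem orderOf_iterate_ringEquiv {F : Type*} [Field F] (σ : F ≃+* F) (j : ℕ) (a : F) :
    orderOf ((⇑σ)^[j] a) = orderOf a := by
  induction j with
  | zero => rfl
  | succ j ih =>
    rw [Function.iterate_succ_apply', ← ih]
    exact MulEquiv.orderOf_eq σ.toMulEquiv _

theorem orderOf_sNorm {F : Type*} [Field F] [Finite F] {p r : ℕ} {σ : F ≃+* F}
    (hσ : ∀ a : F, σ a = a ^ p ^ r) (i : ℕ) {a : F} (ha : a ≠ 0) :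
    orderOf (sNorm σ i a) = orderOf a / Nat.gcd (brk p r i) (orderOf a) := by
  have h := orderOf_pow (n := brk p r i) (Units.mk0 a ha)
  rw [← orderOf_units, ← orderOf_units, Units.val_pow_eq_pow_val, Units.val_mk0] at h
  rw [sNorm_eq_pow_brk hσ, h, Nat.gcd_comm]

/-- Number of rank `(n,ℓ,σ,𝔽_{q'})`-equivalence classes for skew trinomial codes:
the index of the cyclic subgroup `H_{ℓ,𝔽_{q'}}` of `𝔽_q^* × 𝔽_q^*` generated by
`(N_n^σ(ζ), N_{n−ℓ}^σ(σ^ℓ(ζ)))`. -/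
theorem rank_equiv_num_classes
    (p s r : ℕ) (hp : p.Prime) (hs : 1 ≤ s) (hr : r < s)
    (F : Type*) [Field F] [Fintype F] (hF : Fintype.card F = p ^ s)
    (σ : F ≃+* F) (hσ : ∀ a : F, σ a = a ^ p ^ r)
    (K' : Subfield F) (q' : ℕ) (hq' : Nat.card K' = q')
    (ζ : F) (hζK : ζ ∈ K') (hζ0 : ζ ≠ 0)
    (hζ : ∀ x : F, x ∈ K' → x ≠ 0 → ∃ m : ℕ, x = ζ ^ m)
    (ℓ n : ℕ) (hℓ : 0 < ℓ) (hℓn : ℓ < n)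
    (u₀ uℓ : Fˣ)
    (hu₀ : (u₀ : F) = sNorm σ n ζ)
    (huℓ : (uℓ : F) = sNorm σ (n - ℓ) ((⇑σ)^[ℓ] ζ)) :
    (Subgroup.zpowers ((u₀, uℓ) : Fˣ × Fˣ)).index =
      (p ^ s - 1) ^ 2 /
        Nat.lcm ((q' - 1) / Nat.gcd (brk p r n) (q' - 1))
          ((q' - 1) / Nat.gcd (brk p r (n - ℓ)) (q' - 1)) := by
  have hζord : orderOf ζ = q' - 1 := hq' ▸ orderOf_eq_card_subfield_sub_one K' hζK hζ0 hζ
  have hσζ0 : (⇑σ)^[ℓ] ζ ≠ 0 := by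
    rw [iterate_eq_pow_pow hσ]
    exact pow_ne_zero _ hζ0
  have hord : orderOf ((u₀, uℓ) : Fˣ × Fˣ) =
      Nat.lcm ((q' - 1) / Nat.gcd (brk p r n) (q' - 1))
        ((q' - 1) / Nat.gcd (brk p r (n - ℓ)) (q' - 1)) := by
    rw [Prod.orderOf_mk, ← orderOf_units, ← orderOf_units, hu₀, huℓ, orderOf_sNorm hσ _ hζ0,
      orderOf_sNorm hσ _ hσζ0, orderOf_iterate_ringEquiv, hζord]
  have hcard : Nat.card (Fˣ × Fˣ) = (p ^ s - 1) ^ 2 := by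
    rw [Nat.card_prod, Nat.card_units, Nat.card_eq_fintype_card, hF, sq]
  rw [← hord, ← hcard, ← Nat.card_zpowers]
  exact (Nat.div_eq_of_eq_mul_left Nat.card_pos (Subgroup.index_mul_card _).symm).symm
end
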